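/- For every n ≥ 4 and every k with 2 ≤ k ≤ n−2, H(BS_{n,k}) < H(BS_{n,k+1}). In particular H(P_n) = H(BS_{n,2}) < H(BS_{n,3}) < … < H(BS_{n,n−1}) = H(S_n). -/

import Mathlib

open Finset SimpleGraph

open Classical in
/-- The Harary index: half the sum, over ordered pairs of distinct vertices, of the
reciprocal of the shortest-path distance (so each unordered pair is counted once). -/
noncomputable def harary {V : Type*} [Fintype V] (G : SimpleGraph V) : ℝ :=
  (∑ u : V, ∑ v : V, if u = v then 0 else (1 : ℝ) / (G.dist u v)) / 2

/-- The path graph `P_n` on `n` vertices. -/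
def pathG (n : ℕ) : SimpleGraph (Fin n) :=
  SimpleGraph.fromRel (fun x y => (y : ℕ) = (x : ℕ) + 1)

/-- The star graph `S_n` on `n` vertices, with center `0`. -/
def starG (n : ℕ) : SimpleGraph (Fin n) :=
  SimpleGraph.fromRel (fun x y => (x : ℕ) = 0 ∧ (y : ℕ) ≠ 0)

/-- The spider (starlike tree) `S(L 0, …, L (k-1))`: a center `none` together with `k`
disjoint paths, the `i`-th having `L i` vertices, the center joined to vertex `0` of each leg. -/
def spider {k : ℕ} (L : Fin k → ℕ) : SimpleGraph (Option (Σ i : Fin k, Fin (L i))) :=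
  SimpleGraph.fromRel (fun x y =>
    (∃ (i : Fin k) (j : Fin (L i)), x = none ∧ y = some ⟨i, j⟩ ∧ (j : ℕ) = 0) ∨
    (∃ (i : Fin k) (j j' : Fin (L i)),
      x = some ⟨i, j⟩ ∧ y = some ⟨i, j'⟩ ∧ (j' : ℕ) = (j : ℕ) + 1))

/-- Leg lengths of the balanced starlike tree `BS n k`: the legs sum to `n - 1` and
pairwise differ by at most `1`. -/
def balancedLegs (n k : ℕ) : Fin k → ℕ :=
  fun i => (n - 1) / k + if (i : ℕ) < (n - 1) % k then 1 else 0

/-- The balanced starlike tree `BS_{n,k}` on `n` vertices with `k` legs of almost equal length. -/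
def BS (n k : ℕ) : SimpleGraph (Option (Σ i : Fin k, Fin (balancedLegs n k i))) :=
  spider (balancedLegs n k)

/-- Leg lengths of the broom `B_{n,k}`: one leg with `n - k` vertices, `k - 1` legs with one. -/
def broomLegs (n k : ℕ) : Fin k → ℕ := fun i => if (i : ℕ) = 0 then n - k else 1

/-- The broom `B_{n,k} = S(n-k, 1, …, 1)`. -/
def broom (n k : ℕ) : SimpleGraph (Option (Σ i : Fin k, Fin (broomLegs n k i))) :=
  spider (broomLegs n k)

/-- Leg lengths of the spur `A_{n,m}`: `n - m - 1` legs with two vertices, the rest with one. -/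
def spurLegs (n m : ℕ) : Fin m → ℕ := fun i => if (i : ℕ) < n - m - 1 then 2 else 1

/-- The spur `A_{n,m}`: the star `S_{m+1}` with a pendent edge attached to `n - m - 1`
of its pendent vertices. -/
def spur (n m : ℕ) : SimpleGraph (Option (Σ i : Fin m, Fin (spurLegs n m i))) :=
  spider (spurLegs n m)

/-- The caterpillar `C_{n,d,i}`: a path `v_0 v_1 … v_d` with `n - d - 1` pendent
vertices attached at `v_i`. -/
def caterpillar (n d i : ℕ) : SimpleGraph (Fin (d + 1) ⊕ Fin (n - d - 1)) :=
  SimpleGraph.fromRel (fun x y =>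
    (∃ a b : Fin (d + 1), x = Sum.inl a ∧ y = Sum.inl b ∧ (b : ℕ) = (a : ℕ) + 1) ∨
    (∃ (a : Fin (d + 1)) (p : Fin (n - d - 1)), (a : ℕ) = i ∧ x = Sum.inl a ∧ y = Sum.inr p))

/-- Degree of a vertex. -/
noncomputable def deg {V : Type*} [Fintype V] (G : SimpleGraph V) (v : V) : ℕ :=
  (G.neighborSet v).ncard

/-- Eccentricity of a vertex: the maximum distance to another vertex. -/
noncomputable def ecc {V : Type*} [Fintype V] (G : SimpleGraph V) (v : V) : ℕ :=
  Finset.univ.sup fun u => G.dist v u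

/-- Diameter of a graph: the maximum eccentricity. -/
noncomputable def graphDiam {V : Type*} [Fintype V] (G : SimpleGraph V) : ℕ :=
  Finset.univ.sup fun v => ecc G v

/-- Radius of a graph: the minimum eccentricity. -/
noncomputable def graphRadius {V : Type*} [Fintype V] (G : SimpleGraph V) : ℕ :=
  sInf (Set.range fun v => ecc G v)

/-- Matching number: the maximum cardinality of a set of pairwise non-incident edges. -/
noncomputable def matchingNumber {V : Type*} [Fintype V] (G : SimpleGraph V) : ℕ :=
  sSup {k | ∃ M : Finset (Sym2 V), M.card = k ∧ (∀ e ∈ M, e ∈ G.edgeSet) ∧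
    ∀ e ∈ M, ∀ f ∈ M, e ≠ f → ∀ v : V, ¬(v ∈ e ∧ v ∈ f)}

/-- Independence number: the maximum cardinality of a set of pairwise non-adjacent vertices. -/
noncomputable def indepNum {V : Type*} [Fintype V] (G : SimpleGraph V) : ℕ :=
  sSup {k | ∃ s : Finset V, s.card = k ∧ ∀ u ∈ s, ∀ v ∈ s, u ≠ v → ¬ G.Adj u v}


/-- A function `f` that vanishes exactly at `u`, grows by at most one along each edge, and
decreases by one along some edge at every other vertex is the distance from `u`. -/
lemma dist_eq_of_lipschitz_of_descent {V : Type*} {G : SimpleGraph V} {u : V} {f : V → ℕ}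
    (hu : f u = 0) (hzero : ∀ v, f v = 0 → v = u)
    (hlip : ∀ v w, G.Adj v w → f w ≤ f v + 1)
    (hdesc : ∀ v, f v ≠ 0 → ∃ w, G.Adj w v ∧ f v = f w + 1) (v : V) :
    G.dist u v = f v := by
  have upper : ∀ m v, f v = m → ∃ p : G.Walk u v, p.length = m := by
    intro m
    induction m with
    | zero =>
      intro v hv
      obtain rfl := hzero v hv
      exact ⟨Walk.nil, rfl⟩
    | succ m ih =>
      intro v hv
      obtain ⟨w, hw, hfw⟩ := hdesc v (by omega)
      obtain ⟨p, hp⟩ := ih w (by omega)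
      exact ⟨p.concat hw, by simp [hp]⟩
  have lower : ∀ (a b : V) (p : G.Walk a b), f b ≤ f a + p.length := by
    intro a b p
    induction p with
    | nil => simp
    | cons h p ih =>
      have := hlip _ _ h
      simp only [Walk.length_cons]
      omega
  obtain ⟨p, hp⟩ := upper _ v rfl
  refine le_antisymm (hp ▸ dist_le p) ?_
  obtain ⟨q, hq⟩ := p.reachable.exists_walk_length_eq_dist
  have := lower _ _ q
  omega

lemma harary_eq_sum_dist {V : Type*} [Fintype V] (G : SimpleGraph V) :
    harary G = (∑ u : V, ∑ v : V, (1 : ℝ) / (G.dist u v)) / 2 := by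
  unfold harary
  congr 1
  refine Finset.sum_congr rfl fun u _ => Finset.sum_congr rfl fun v _ => ?_
  split_ifs with h
  · simp [h]
  · rfl

/-- The sum of reciprocal distances over ordered pairs of vertices of a path on `m` vertices. -/
noncomputable def pathSum (m : ℕ) : ℝ :=
  ∑ i ∈ range m, ∑ j ∈ range m, (1 : ℝ) / ((i - j + (j - i) : ℕ) : ℝ)

/-- The sum of reciprocal distances between the vertices of two different legs, with `p` and `q`
vertices, of a spider. -/
noncomputable def crossSum (p q : ℕ) : ℝ :=
  ∑ a ∈ range p, ∑ b ∈ range q, (1 : ℝ) / ((a + b + 2 : ℕ) : ℝ)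

/-- The sum of the reciprocals of `1, …, m`. -/
noncomputable def recipSum (m : ℕ) : ℝ := ∑ a ∈ range m, (1 : ℝ) / ((a + 1 : ℕ) : ℝ)

lemma pathSum_succ (m : ℕ) : pathSum (m + 1) = pathSum m + 2 * recipSum m := by
  have left : ∑ i ∈ range m, (1 : ℝ) / ((i - m + (m - i) : ℕ) : ℝ) = recipSum m := by
    rw [recipSum, ← Finset.sum_range_reflect]
    refine Finset.sum_congr rfl fun i hi => ?_
    rw [Finset.mem_range] at hi
    congr 2
    omega
  have right : ∑ j ∈ range m, (1 : ℝ) / ((m - j + (j - m) : ℕ) : ℝ) = recipSum m := by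
    rw [← left]
    exact Finset.sum_congr rfl fun j _ => by rw [add_comm]
  simp only [pathSum, Finset.sum_range_succ, Finset.sum_add_distrib, left, right]
  simp
  ring

lemma crossSum_succ_right (p q : ℕ) :
    crossSum p (q + 1) = crossSum p q + ∑ a ∈ range p, (1 : ℝ) / ((a + q + 2 : ℕ) : ℝ) := by
  simp only [crossSum, Finset.sum_range_succ, Finset.sum_add_distrib]

lemma crossSum_succ_left (p q : ℕ) :
    crossSum (p + 1) q = crossSum p q + ∑ b ∈ range q, (1 : ℝ) / ((p + b + 2 : ℕ) : ℝ) := by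
  simp only [crossSum, Finset.sum_range_succ]

lemma crossSum_comm (p q : ℕ) : crossSum p q = crossSum q p := by
  unfold crossSum
  rw [Finset.sum_comm]
  simp only [add_comm]

@[simp] lemma crossSum_zero_left (q : ℕ) : crossSum 0 q = 0 := by simp [crossSum]

@[simp] lemma crossSum_zero_right (p : ℕ) : crossSum p 0 = 0 := by simp [crossSum]

@[simp] lemma pathSum_one : pathSum 1 = 0 := by simp [pathSum]

lemma recipSum_add (p q : ℕ) :
    recipSum (q + p) = recipSum q + ∑ a ∈ range p, (1 : ℝ) / ((a + q + 1 : ℕ) : ℝ) := by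
  rw [recipSum, Finset.sum_range_add]
  simp only [recipSum, add_comm q]

/-- Cutting a path at a vertex into two legs. -/
lemma pathSum_add (p q : ℕ) :
    pathSum (p + q + 1) = pathSum (p + 1) + pathSum (q + 1) + 2 * crossSum p q := by
  induction q with
  | zero => simp
  | succ q ih =>
    have h := recipSum_add p (q + 1)
    rw [show p + (q + 1) + 1 = (p + q + 1) + 1 by ring, pathSum_succ (p + q + 1), ih,
      pathSum_succ (q + 1), crossSum_succ_right, show p + q + 1 = q + 1 + p by ring, h]
    simp only [show ∀ a, a + (q + 1) + 1 = a + q + 2 by intro a; ring]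
    ring

/-- Twice the Harary index of a spider, in terms of its leg lengths. -/
noncomputable def legSum {ι : Type*} [Fintype ι] (L : ι → ℕ) : ℝ :=
  ∑ i, (pathSum (L i + 1) - crossSum (L i) (L i)) + ∑ i, ∑ j, crossSum (L i) (L j)

/-- Moving a leaf from a leg to the end of a leg shorter by at least two increases the
Harary index, provided a third leg is nonempty. -/
lemma legSum_lt_of_move {ι : Type*} [Fintype ι] [DecidableEq ι] {L L' : ι → ℕ} {s t r : ι}
    {p q : ℕ} (hst : s ≠ t) (hrs : r ≠ s) (hrt : r ≠ t) (hr : 0 < L r) (hqp : q < p)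
    (hLs : L s = p + 1) (hLs' : L' s = p) (hLt : L t = q) (hLt' : L' t = q + 1)
    (hrest : ∀ i, i ≠ s → i ≠ t → L' i = L i) :
    legSum L < legSum L' := by
  have split : ∀ f : ι → ℝ, ∑ i, f i = f s + f t + ∑ i ∈ (univ.erase s).erase t, f i := by
    intro f
    rw [← Finset.add_sum_erase _ _ (Finset.mem_univ s),
      ← Finset.add_sum_erase (univ.erase s) _ (a := t) (by simp [hst.symm]), add_assoc]
  have expand : ∀ M : ι → ℕ, legSum M = pathSum (M s + M t + 1)
      + 2 * ∑ i ∈ (univ.erase s).erase t, (crossSum (M s) (M i) + crossSum (M t) (M i))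
      + (∑ i ∈ (univ.erase s).erase t, (pathSum (M i + 1) - crossSum (M i) (M i))
        + ∑ i ∈ (univ.erase s).erase t, ∑ j ∈ (univ.erase s).erase t,
          crossSum (M i) (M j)) := by
    intro M
    have comm : ∀ u, ∑ i ∈ (univ.erase s).erase t, crossSum (M i) (M u)
        = ∑ i ∈ (univ.erase s).erase t, crossSum (M u) (M i) :=
      fun u => Finset.sum_congr rfl fun i _ => crossSum_comm _ _
    simp only [legSum, split, Finset.sum_add_distrib, pathSum_add (M s) (M t), comm,
      crossSum_comm (M t) (M s)]
    ring
  have outside : ∀ i ∈ (univ.erase s).erase t, L' i = L i := by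
    intro i hi
    simp only [Finset.mem_erase, Finset.mem_univ, and_true] at hi
    exact hrest i hi.2 hi.1
  rw [expand L, expand L', hLs, hLs', hLt, hLt', show p + 1 + q + 1 = p + (q + 1) + 1 by ring]
  have const₁ : ∑ i ∈ (univ.erase s).erase t, (pathSum (L' i + 1) - crossSum (L' i) (L' i))
      = ∑ i ∈ (univ.erase s).erase t, (pathSum (L i + 1) - crossSum (L i) (L i)) :=
    Finset.sum_congr rfl fun i hi => by rw [outside i hi]
  have const₂ : ∑ i ∈ (univ.erase s).erase t, ∑ j ∈ (univ.erase s).erase t,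
        crossSum (L' i) (L' j)
      = ∑ i ∈ (univ.erase s).erase t, ∑ j ∈ (univ.erase s).erase t, crossSum (L i) (L j) :=
    Finset.sum_congr rfl fun i hi => Finset.sum_congr rfl fun j hj => by
      rw [outside i hi, outside j hj]
  have term_lt : ∀ b : ℕ, (1 : ℝ) / ((p + b + 2 : ℕ) : ℝ) < 1 / ((q + b + 2 : ℕ) : ℝ) := by
    intro b
    apply one_div_lt_one_div_of_lt
    · positivity
    · exact_mod_cast (by omega : q + b + 2 < p + b + 2)
  have gain : ∑ i ∈ (univ.erase s).erase t, (crossSum (p + 1) (L i) + crossSum q (L i))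
      < ∑ i ∈ (univ.erase s).erase t, (crossSum p (L' i) + crossSum (q + 1) (L' i)) := by
    apply Finset.sum_lt_sum
    · intro i hi
      rw [outside i hi, crossSum_succ_left, crossSum_succ_left]
      have := Finset.sum_le_sum fun b (_ : b ∈ range (L i)) => (term_lt b).le
      linarith
    · have hmem : r ∈ (univ.erase s).erase t := by simp [hrs, hrt]
      refine ⟨r, hmem, ?_⟩
      rw [outside r hmem, crossSum_succ_left, crossSum_succ_left]
      have := Finset.sum_lt_sum_of_nonempty (Finset.nonempty_range_iff.mpr hr.ne')
        fun b (_ : b ∈ range (L r)) => term_lt b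
      linarith
  rw [const₁, const₂]
  linarith

/-- If `T` arises from `L` by shortening legs other than `t` in favour of the leg `t`, which
remains a shortest one, then `T` has the larger Harary index. -/
lemma legSum_lt_of_transfer {ι : Type*} [Fintype ι] [DecidableEq ι] (hcard : 3 ≤ Fintype.card ι)
    {T : ι → ℕ} {t : ι} (hmin : ∀ i, T t ≤ T i) (d : ℕ) (L : ι → ℕ)
    (hd : T t = L t + (d + 1)) (hle : ∀ i, i ≠ t → T i ≤ L i) (hsum : ∑ i, L i = ∑ i, T i) :
    legSum L < legSum T := by
  induction d using Nat.strong_induction_on generalizing L with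
  | _ d ih =>
  have hlt : L t < T t := by omega
  obtain ⟨s, hst, hs⟩ : ∃ s, s ≠ t ∧ T s < L s := by
    by_contra! h
    refine (Finset.sum_lt_sum (s := univ) (f := L) (g := T) (fun i _ => ?_)
      ⟨t, Finset.mem_univ t, hlt⟩).ne hsum
    by_cases hi : i = t
    · exact hi ▸ hlt.le
    · exact h i hi
  obtain ⟨r, hr⟩ : (({s, t} : Finset ι)ᶜ).Nonempty := by
    rw [← Finset.card_pos, Finset.card_compl, Finset.card_pair hst]
    omega
  simp only [Finset.mem_compl, Finset.mem_insert, Finset.mem_singleton, not_or] at hr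
  have hts := hmin s
  have htr := hmin r
  have hTr := hle r hr.2
  obtain ⟨L', hL'⟩ : ∃ L' : ι → ℕ,
      L' = Function.update (Function.update L s (L s - 1)) t (L t + 1) := ⟨_, rfl⟩
  have hs' : L' s = L s - 1 := by simp [hL', hst]
  have ht' : L' t = L t + 1 := by simp [hL']
  have hrest : ∀ i, i ≠ s → i ≠ t → L' i = L i := fun i his hit => by simp [hL', his, hit]
  have hmove : legSum L < legSum L' :=
    legSum_lt_of_move (p := L s - 1) (q := L t) hst hr.1 hr.2 (by omega) (by omega) (by omega)
      hs' rfl ht' hrest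
  have hle' : ∀ i, i ≠ t → T i ≤ L' i := by
    intro i hi
    by_cases his : i = s
    · subst his; omega
    · rw [hrest i his hi]; exact hle i hi
  have hsum' : ∑ i, L' i = ∑ i, T i := by
    have split : ∀ f : ι → ℕ, ∑ i, f i = f s + (f t + ∑ i ∈ (univ.erase s).erase t, f i) := by
      intro f
      rw [← Finset.add_sum_erase _ _ (Finset.mem_univ s),
        ← Finset.add_sum_erase (univ.erase s) _ (a := t) (by simp [hst.symm])]
    have outside : ∑ i ∈ (univ.erase s).erase t, L' i = ∑ i ∈ (univ.erase s).erase t, L i := by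
      refine Finset.sum_congr rfl fun i hi => ?_
      simp only [Finset.mem_erase, Finset.mem_univ, and_true] at hi
      exact hrest i hi.2 hi.1
    rw [← hsum, split L, split L', outside, hs', ht']
    omega
  cases d with
  | zero =>
    have hall : ∀ i ∈ univ, T i ≤ L' i := by
      intro i _
      by_cases hi : i = t
      · subst hi; omega
      · exact hle' i hi
    have heq : L' = T :=
      funext fun i => ((Finset.sum_eq_sum_iff_of_le hall).1 hsum'.symm i (Finset.mem_univ i)).symm
    exact heq ▸ hmove
  | succ d => exact hmove.trans (ih d (by omega) L' (by omega) hle' hsum')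

/-- The distance between two vertices of a spider. -/
def spiderDist {k : ℕ} (L : Fin k → ℕ) :
    Option (Σ i : Fin k, Fin (L i)) → Option (Σ i : Fin k, Fin (L i)) → ℕ
  | none, none => 0
  | none, some y => y.2 + 1
  | some x, none => x.2 + 1
  | some x, some y =>
    if x.1 = y.1 then (x.2 : ℕ) - y.2 + ((y.2 : ℕ) - x.2) else (x.2 : ℕ) + y.2 + 2

lemma spider_adj_none_some {k : ℕ} (L : Fin k → ℕ) (i : Fin k) (j : Fin (L i))
    (hj : (j : ℕ) = 0) : (spider L).Adj none (some ⟨i, j⟩) := by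
  rw [spider, SimpleGraph.fromRel_adj]
  exact ⟨by simp, Or.inl (Or.inl ⟨i, j, rfl, rfl, hj⟩)⟩

lemma spider_adj_some_some {k : ℕ} (L : Fin k → ℕ) (i : Fin k) (j j' : Fin (L i))
    (hj : (j' : ℕ) = j + 1) : (spider L).Adj (some ⟨i, j⟩) (some ⟨i, j'⟩) := by
  rw [spider, SimpleGraph.fromRel_adj]
  refine ⟨?_, Or.inl (Or.inr ⟨i, j, j', rfl, rfl, hj⟩)⟩
  intro h
  simp only [Option.some.injEq, Sigma.mk.injEq, heq_eq_eq, true_and] at h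
  subst h
  omega

lemma spider_adj_pred {k : ℕ} (L : Fin k → ℕ) (i : Fin k) (j : Fin (L i)) (hj : (j : ℕ) ≠ 0) :
    (spider L).Adj (some ⟨i, ⟨j - 1, by omega⟩⟩) (some ⟨i, j⟩) :=
  spider_adj_some_some L i _ _ (by simp only; omega)

lemma spider_dist {k : ℕ} (L : Fin k → ℕ) (u v : Option (Σ i : Fin k, Fin (L i))) :
    (spider L).dist u v = spiderDist L u v := by
  refine dist_eq_of_lipschitz_of_descent (f := spiderDist L u) ?_ ?_ ?_ ?_ v
  · rcases u with _ | ⟨i, j⟩ <;> simp [spiderDist]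
  · intro v hv
    rcases u with _ | ⟨i, j⟩ <;> rcases v with _ | ⟨i', j'⟩
    · rfl
    · simp [spiderDist] at hv
    · simp [spiderDist] at hv
    · by_cases h : i = i'
      · subst h
        simp only [spiderDist, if_true] at hv
        obtain rfl : j' = j := Fin.ext (by omega)
        rfl
      · simp [spiderDist, h] at hv
  · intro v w hvw
    rw [spider, SimpleGraph.fromRel_adj] at hvw
    rcases hvw with ⟨-, (⟨i, j, rfl, rfl, hj⟩ | ⟨i, j, j', rfl, rfl, hj⟩) |
      (⟨i, j, rfl, rfl, hj⟩ | ⟨i, j, j', rfl, rfl, hj⟩)⟩ <;>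
    rcases u with _ | ⟨a, b⟩ <;> simp only [spiderDist] <;> try split_ifs
    all_goals omega
  · intro v hv
    rcases v with _ | ⟨i, j⟩
    · rcases u with _ | ⟨a, b⟩
      · simp [spiderDist] at hv
      · by_cases hb : (b : ℕ) = 0
        · exact ⟨_, (spider_adj_none_some L a b hb).symm, by simp [spiderDist, hb]⟩
        · refine ⟨some ⟨a, ⟨0, by omega⟩⟩, (spider_adj_none_some L a _ rfl).symm, ?_⟩
          simp [spiderDist]
    · rcases u with _ | ⟨a, b⟩
      · by_cases hj : (j : ℕ) = 0
        · exact ⟨_, spider_adj_none_some L i j hj, by simp [spiderDist, hj]⟩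
        · refine ⟨_, spider_adj_pred L i j hj, ?_⟩
          simp only [spiderDist]
          omega
      · by_cases h : a = i
        · subst h
          simp only [spiderDist, if_true] at hv
          by_cases hjb : (j : ℕ) < b
          · refine ⟨some ⟨a, ⟨j + 1, by omega⟩⟩, (spider_adj_some_some L a j _ rfl).symm, ?_⟩
            simp only [spiderDist, if_true]
            omega
          · refine ⟨_, spider_adj_pred L a j (by omega), ?_⟩
            simp only [spiderDist, if_true]
            omega
        · by_cases hj : (j : ℕ) = 0
          · exact ⟨_, spider_adj_none_some L i j hj, by simp [spiderDist, hj, h]⟩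
          · refine ⟨_, spider_adj_pred L i j hj, ?_⟩
            simp only [spiderDist, if_neg h]
            omega

lemma harary_spider {k : ℕ} (L : Fin k → ℕ) : harary (spider L) = legSum L / 2 := by
  have inner : ∀ i i' : Fin k, (∑ j : Fin (L i), ∑ j' : Fin (L i'),
      (1 : ℝ) / (spiderDist L (some ⟨i, j⟩) (some ⟨i', j'⟩)))
      = (if i = i' then pathSum (L i) - crossSum (L i) (L i) else 0)
        + crossSum (L i) (L i') := by
    intro i i'
    by_cases h : i = i'
    · subst h
      simp only [spiderDist, if_true, sub_add_cancel, pathSum, Finset.sum_range]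
    · simp only [spiderDist, if_neg h, zero_add, crossSum, Finset.sum_range]
  have swap : ∀ i : Fin k, (∑ j : Fin (L i), ∑ i' : Fin k, ∑ j' : Fin (L i'),
      (1 : ℝ) / (spiderDist L (some ⟨i, j⟩) (some ⟨i', j'⟩)))
      = pathSum (L i) - crossSum (L i) (L i) + ∑ i', crossSum (L i) (L i') := by
    intro i
    rw [Finset.sum_comm]
    simp only [inner, Finset.sum_add_distrib, Finset.sum_ite_eq, Finset.mem_univ, if_true]
  have center : ∀ i, ∑ j : Fin (L i), (1 : ℝ) / ((j + 1 : ℕ) : ℝ) = recipSum (L i) := by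
    intro i
    simp only [recipSum, Finset.sum_range]
  rw [harary_eq_sum_dist]
  congr 1
  simp only [spider_dist, Fintype.sum_option, Fintype.sum_sigma, Finset.sum_add_distrib, swap]
  simp only [spiderDist, center, legSum, pathSum_succ, Finset.sum_add_distrib,
    Finset.sum_sub_distrib, ← Finset.mul_sum]
  simp
  ring

lemma pathG_dist (n : ℕ) (u v : Fin n) :
    (pathG n).dist u v = (u : ℕ) - v + ((v : ℕ) - u) := by
  have adj : ∀ a b : Fin n, (b : ℕ) = a + 1 → (pathG n).Adj a b := by
    intro a b h
    rw [pathG, SimpleGraph.fromRel_adj]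
    refine ⟨fun hab => ?_, Or.inl h⟩
    subst hab
    omega
  refine dist_eq_of_lipschitz_of_descent (f := fun v : Fin n => (u : ℕ) - v + ((v : ℕ) - u))
    ?_ ?_ ?_ ?_ v
  · simp
  · intro v hv
    exact Fin.ext (by omega)
  · intro v w h
    rw [pathG, SimpleGraph.fromRel_adj] at h
    omega
  · intro v hv
    by_cases h : (v : ℕ) < u
    · exact ⟨⟨v + 1, by omega⟩, (adj v _ rfl).symm, by simp only; omega⟩
    · exact ⟨⟨v - 1, by omega⟩, adj _ v (by simp only; omega), by simp only; omega⟩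

lemma harary_pathG (n : ℕ) : harary (pathG n) = pathSum n / 2 := by
  rw [harary_eq_sum_dist]
  simp only [pathG_dist, pathSum, Finset.sum_range]

lemma starG_dist (k : ℕ) (u v : Fin (k + 1)) :
    (starG (k + 1)).dist u v = if u = v then 0 else if u = 0 ∨ v = 0 then 1 else 2 := by
  have adj : ∀ b : Fin (k + 1), b ≠ 0 → (starG (k + 1)).Adj 0 b := by
    intro b h
    rw [starG, SimpleGraph.fromRel_adj]
    exact ⟨h.symm, Or.inl ⟨rfl, fun hb => h (Fin.ext hb)⟩⟩
  refine dist_eq_of_lipschitz_of_descent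
    (f := fun v : Fin (k + 1) => if u = v then 0 else if u = 0 ∨ v = 0 then 1 else 2)
    ?_ ?_ ?_ ?_ v
  · simp
  · intro v hv
    split_ifs at hv with h
    exact h.symm
  · intro v w h
    rw [starG, SimpleGraph.fromRel_adj] at h
    have hvw : v = 0 ∨ w = 0 := h.2.imp (fun h => Fin.ext h.1) (fun h => Fin.ext h.1)
    split_ifs <;> grind
  · intro v hv
    have huv : u ≠ v := fun h => hv (by simp [h])
    by_cases hv0 : v = 0
    · subst hv0
      exact ⟨u, (adj u huv).symm, by simp [huv]⟩
    · refine ⟨0, adj v hv0, ?_⟩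
      by_cases hu0 : u = 0 <;> simp [huv, hu0, hv0]
      intro h
      exact absurd h.symm hv0

lemma harary_starG (k : ℕ) : harary (starG (k + 1)) = legSum (fun _ : Fin k => 1) / 2 := by
  have hpath : pathSum 2 = 2 := by simp [pathSum_succ 1, recipSum]
  have hcross : crossSum 1 1 = 1 / 2 := by simp [crossSum]
  have row : ∀ u : Fin k, (∑ v : Fin k, (1 : ℝ) /
      ((if u = v then 0 else 2 : ℕ) : ℝ)) = ∑ v : Fin k, (1 / 2 - if u = v then 1 / 2 else 0) :=
    fun u => Finset.sum_congr rfl fun v _ => by split_ifs <;> simp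
  rw [harary_eq_sum_dist]
  congr 1
  simp only [starG_dist, Fin.sum_univ_succ, Fin.succ_inj, Fin.succ_ne_zero, or_self, if_false,
    legSum, hpath, hcross, row]
  simp [(Fin.succ_ne_zero _).symm]
  ring

lemma sum_balancedLegs (n k : ℕ) (hk : 0 < k) : ∑ i, balancedLegs n k i = n - 1 := by
  have hcount : ∑ i : Fin k, (if (i : ℕ) < (n - 1) % k then 1 else 0) = (n - 1) % k := by
    rw [Fin.sum_univ_eq_sum_range (fun i => if i < (n - 1) % k then 1 else 0),
      Finset.sum_boole, Nat.cast_id]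
    have : (range k).filter (fun i => i < (n - 1) % k) = range ((n - 1) % k) := by
      ext i
      have := Nat.mod_lt (n - 1) hk
      simp only [Finset.mem_filter, Finset.mem_range]
      omega
    rw [this, Finset.card_range]
  simp only [balancedLegs, Finset.sum_add_distrib, hcount]
  simp [Nat.div_add_mod]

lemma balancedLegs_succ_le (n k : ℕ) (hk : 0 < k) (i : Fin k) :
    balancedLegs n (k + 1) i.castSucc ≤ balancedLegs n k i := by
  have h₁ := Nat.div_add_mod (n - 1) (k + 1)
  have h₂ := Nat.div_add_mod (n - 1) k
  have hle : (n - 1) / (k + 1) ≤ (n - 1) / k := Nat.div_le_div_left (Nat.le_succ k) hk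
  simp only [balancedLegs, Fin.val_castSucc]
  rcases hle.eq_or_lt with h | h
  · rw [← h] at h₂ ⊢
    have : (n - 1) % k = (n - 1) / (k + 1) + (n - 1) % (k + 1) := by
      rw [add_mul, one_mul] at h₁
      omega
    have := this ▸ Nat.le_add_left ((n - 1) % (k + 1)) ((n - 1) / (k + 1))
    split_ifs <;> omega
  · split_ifs <;> omega

lemma balancedLegs_last (n k : ℕ) :
    balancedLegs n (k + 1) (Fin.last k) = (n - 1) / (k + 1) := by
  have : (n - 1) % (k + 1) < k + 1 := Nat.mod_lt _ (Nat.succ_pos k)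
  simp only [balancedLegs, Fin.val_last]
  rw [if_neg (by omega), add_zero]

lemma legSum_snoc_zero {k : ℕ} (L : Fin k → ℕ) :
    legSum (Fin.snoc L 0 : Fin (k + 1) → ℕ) = legSum L := by
  simp [legSum, Fin.sum_univ_castSucc]

lemma harary_BS_lt_harary_BS_succ {n k : ℕ} (hk2 : 2 ≤ k) (hkn : k + 1 ≤ n - 1) :
    harary (BS n k) < harary (BS n (k + 1)) := by
  have hpos : 0 < (n - 1) / (k + 1) := Nat.div_pos hkn (Nat.succ_pos k)
  rw [BS, BS, harary_spider, harary_spider, ← legSum_snoc_zero (balancedLegs n k)]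
  refine div_lt_div_of_pos_right ?_ two_pos
  refine legSum_lt_of_transfer (t := Fin.last k) (by simp; omega) ?_ ((n - 1) / (k + 1) - 1) _
    ?_ ?_ ?_
  · intro i
    rw [balancedLegs_last]
    exact Nat.le_add_right _ _
  · rw [balancedLegs_last, Fin.snoc_last]
    omega
  · intro i hi
    obtain ⟨j, rfl⟩ := Fin.exists_castSucc_eq.2 hi
    rw [Fin.snoc_castSucc (α := fun _ => ℕ)]
    exact balancedLegs_succ_le n k (by omega) j
  · rw [sum_balancedLegs n (k + 1) (by omega), Fin.sum_univ_castSucc]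
    simp [sum_balancedLegs n k (by omega)]

lemma harary_pathG_eq_harary_BS_two {n : ℕ} (hn : 1 ≤ n) :
    harary (pathG n) = harary (BS n 2) := by
  have hsum := sum_balancedLegs n 2 two_pos
  rw [Fin.sum_univ_two] at hsum
  have hn' : n = balancedLegs n 2 0 + balancedLegs n 2 1 + 1 := by omega
  rw [harary_pathG, BS, harary_spider, hn', pathSum_add, ← hn']
  simp only [legSum, Fin.sum_univ_two, crossSum_comm (balancedLegs n 2 1) (balancedLegs n 2 0)]
  ring

lemma harary_BS_pred_eq_harary_starG {n : ℕ} (hn : 2 ≤ n) :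
    harary (BS n (n - 1)) = harary (starG n) := by
  obtain ⟨k, rfl⟩ : ∃ k, n = k + 1 := ⟨n - 1, by omega⟩
  have hlegs : balancedLegs (k + 1) (k + 1 - 1) = fun _ => 1 := by
    funext i
    simp [balancedLegs, Nat.div_self (show 0 < k by omega)]
  rw [BS, harary_spider, hlegs, harary_starG]
  rfl

theorem harary_balanced_spider_chain (n k : ℕ) (hn : 4 ≤ n) (hk2 : 2 ≤ k)
    (hkn : k ≤ n - 2) :
    harary (BS n k) < harary (BS n (k + 1)) ∧
    harary (pathG n) = harary (BS n 2) ∧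
    harary (BS n (n - 1)) = harary (starG n) := by
  exact ⟨harary_BS_lt_harary_BS_succ hk2 (by omega), harary_pathG_eq_harary_BS_two (by omega),
    harary_BS_pred_eq_harary_starG (by omega)⟩
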